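/- arXiv:1805.04298 — 11 statements merged into one kernel-verified Lean document; each statement's English description precedes it below -/
import Mathlib

section
/- Let m > 0 and γ ≥ m, and suppose f : [0,1] × ℝ → ℝ is continuously differentiable with m ≤ ∂f/∂y(x,y) ≤ γ for all (x,y). Then for every mesh 0 = x₀ < x₁ < ⋯ < x_N = 1, every ε ∈ (0,1) and every q > 0, the discrete problem F ȳ = 0 has exactly one solution ȳ ∈ ℝ^{N+1}. -/
/-- The discrete operator `F` of the fitted difference scheme on an arbitrary mesh
`0 = x₀ < x₁ < ⋯ < x_N = 1`, with `β = √γ/ε`, `aᵢ = 1/sinh(β h_{i-1})`,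
`dᵢ = 1/tanh(β h_{i-1})`, `Δdᵢ = dᵢ - aᵢ`. -/
noncomputable def schemeF (N : ℕ) (x : ℕ → ℝ) (f : ℝ → ℝ → ℝ) (γ q β : ℝ)
    (y : Fin (N + 1) → ℝ) : Fin (N + 1) → ℝ := fun i =>
  let Y : ℕ → ℝ := fun j => if h : j < N + 1 then y ⟨j, h⟩ else 0
  let a : ℕ → ℝ := fun j => 1 / Real.sinh (β * (x j - x (j - 1)))
  let d : ℕ → ℝ := fun j => 1 / Real.tanh (β * (x j - x (j - 1)))
  let Δd : ℕ → ℝ := fun j => d j - a j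
  if i.val = 0 then Y 0
  else if i.val = N then Y N
  else
    γ / (Δd i.val + Δd (i.val + 1)) *
      (((q + 1) * a i.val + d i.val + Δd (i.val + 1)) * (Y (i.val - 1) - Y i.val)
        - ((q + 1) * a (i.val + 1) + d (i.val + 1) + Δd i.val) * (Y i.val - Y (i.val + 1))
        - (f (x (i.val - 1)) (Y (i.val - 1)) + q * f (x i.val) (Y i.val)
            + f (x (i.val + 1)) (Y (i.val + 1))) / γ * (Δd i.val + Δd (i.val + 1)))

/-- Extension of a grid function on `Fin (N + 1)` to all of `ℕ` by zero. -/
noncomputable def gridExtend {N : ℕ} (y : Fin (N + 1) → ℝ) (j : ℕ) : ℝ :=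
  if h : j < N + 1 then y ⟨j, h⟩ else 0

lemma gridExtend_val {N : ℕ} (y : Fin (N + 1) → ℝ) (i : Fin (N + 1)) :
    gridExtend y i.val = y i := by
  simp only [gridExtend, i.isLt, dite_true, Fin.eta]

lemma abs_gridExtend_sub_le {N : ℕ} (y z : Fin (N + 1) → ℝ) (j : ℕ) :
    |gridExtend y j - gridExtend z j| ≤ dist y z := by
  unfold gridExtend
  split_ifs with h
  · rw [← Real.dist_eq]
    exact dist_le_pi_dist y z ⟨j, h⟩
  · simp

/-- Mean value theorem with two-sided positive bounds on the derivative; the positive lower bound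
makes differentiability automatic. -/
lemma exists_slope_of_deriv_bounds {g : ℝ → ℝ} {m γ : ℝ} (hm : 0 < m)
    (hg : ∀ y, m ≤ deriv g y ∧ deriv g y ≤ γ) (u v : ℝ) :
    ∃ p, m ≤ p ∧ p ≤ γ ∧ g u - g v = p * (u - v) := by
  have hd : Differentiable ℝ g := fun y =>
    differentiableAt_of_deriv_ne_zero (hm.trans_le (hg y).1).ne'
  rcases lt_trichotomy u v with h | rfl | h
  · obtain ⟨c, -, hc⟩ := exists_deriv_eq_slope g h hd.continuous.continuousOn hd.differentiableOn
    refine ⟨deriv g c, (hg c).1, (hg c).2, ?_⟩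
    have : v - u ≠ 0 := (sub_pos.2 h).ne'
    rw [hc]
    field_simp
    ring
  · exact ⟨deriv g u, (hg u).1, (hg u).2, by ring⟩
  · obtain ⟨c, -, hc⟩ := exists_deriv_eq_slope g h hd.continuous.continuousOn hd.differentiableOn
    refine ⟨deriv g c, (hg c).1, (hg c).2, ?_⟩
    have : u - v ≠ 0 := (sub_pos.2 h).ne'
    rw [hc]
    field_simp

/-- One damped relaxation step of a diagonally dominant three-point operator with nonnegative
off-diagonal coefficients contracts the maximum norm. -/
lemma abs_relaxation_le {A B m γ q τ D p₁ p₂ p₃ w₁ w₂ w₃ : ℝ} (hq : 0 ≤ q) (hτ : 0 ≤ τ)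
    (hA : γ ≤ A) (hB : γ ≤ B) (hAB : τ * (A + B + q * γ) ≤ 1)
    (hp₁ : m ≤ p₁ ∧ p₁ ≤ γ) (hp₂ : m ≤ p₂ ∧ p₂ ≤ γ) (hp₃ : m ≤ p₃ ∧ p₃ ≤ γ)
    (hw₁ : |w₁| ≤ D) (hw₂ : |w₂| ≤ D) (hw₃ : |w₃| ≤ D) :
    |w₂ + τ * (A * (w₁ - w₂) - B * (w₂ - w₃) - (p₁ * w₁ + q * (p₂ * w₂) + p₃ * w₃))|
      ≤ (1 - τ * (m * (2 + q))) * D := by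
  have hD : 0 ≤ D := (abs_nonneg _).trans hw₁
  have c₁ : 0 ≤ τ * (A - p₁) := mul_nonneg hτ (by linarith [hp₁.2])
  have c₃ : 0 ≤ τ * (B - p₃) := mul_nonneg hτ (by linarith [hp₃.2])
  have c₂ : 0 ≤ 1 - τ * (A + B + q * p₂) := by
    have : τ * (q * p₂) ≤ τ * (q * γ) := by gcongr; exact hp₂.2
    linarith
  have key : w₂ + τ * (A * (w₁ - w₂) - B * (w₂ - w₃) - (p₁ * w₁ + q * (p₂ * w₂) + p₃ * w₃))
      = τ * (A - p₁) * w₁ + (1 - τ * (A + B + q * p₂)) * w₂ + τ * (B - p₃) * w₃ := by ring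
  have hsum : τ * (m * (2 + q)) ≤ τ * (p₁ + q * p₂ + p₃) := by
    have : q * m ≤ q * p₂ := by gcongr; exact hp₂.1
    gcongr
    linarith [hp₁.1, hp₃.1]
  calc _ ≤ τ * (A - p₁) * |w₁| + (1 - τ * (A + B + q * p₂)) * |w₂| + τ * (B - p₃) * |w₃| := by
        rw [key]
        refine (abs_add_three _ _ _).trans_eq ?_
        rw [abs_mul _ w₁, abs_mul _ w₂, abs_mul _ w₃, abs_of_nonneg c₁, abs_of_nonneg c₂, abs_of_nonneg c₃]
    _ ≤ τ * (A - p₁) * D + (1 - τ * (A + B + q * p₂)) * D + τ * (B - p₃) * D := by gcongr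
    _ = (1 - τ * (p₁ + q * p₂ + p₃)) * D := by ring
    _ ≤ _ := by gcongr

/-- Unique solvability of a nonlinear three-point boundary value problem whose reaction terms
`g j` have derivative in `[m, γ]` with `0 < m`, and whose coupling coefficients are at
least `γ`. -/
lemma existsUnique_threePoint {N : ℕ} {A B : ℕ → ℝ} {g : ℕ → ℝ → ℝ} {m γ q : ℝ}
    (hm : 0 < m) (hmγ : m ≤ γ) (hq : 0 ≤ q)
    (hg : ∀ j ≤ N, ∀ y, m ≤ deriv (g j) y ∧ deriv (g j) y ≤ γ)
    (hA : ∀ i, i ≠ 0 → i < N → γ ≤ A i) (hB : ∀ i, i ≠ 0 → i < N → γ ≤ B i) :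
    ∃! y : Fin (N + 1) → ℝ, ∀ i : Fin (N + 1),
      if i.val = 0 ∨ i.val = N then y i = 0
      else A i * (gridExtend y (i.val - 1) - gridExtend y i)
        - B i * (gridExtend y i - gridExtend y (i.val + 1))
        - (g (i.val - 1) (gridExtend y (i.val - 1)) + q * g i (gridExtend y i)
          + g (i.val + 1) (gridExtend y (i.val + 1))) = 0 := by
  have hγ : 0 < γ := hm.trans_le hmγ
  set R : (Fin (N + 1) → ℝ) → ℕ → ℝ := fun y i =>
    A i * (gridExtend y (i - 1) - gridExtend y i) - B i * (gridExtend y i - gridExtend y (i + 1))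
      - (g (i - 1) (gridExtend y (i - 1)) + q * g i (gridExtend y i)
        + g (i + 1) (gridExtend y (i + 1))) with hR
  set M : ℝ := ∑ i ∈ Finset.range N, (|A i| + |B i|) + (2 + q) * γ with hM
  have hsum : 0 ≤ ∑ i ∈ Finset.range N, (|A i| + |B i|) :=
    Finset.sum_nonneg fun _ _ => by positivity
  have hM0 : 0 < M := by positivity
  have hMAB : ∀ i < N, A i + B i + q * γ ≤ M := by
    intro i hi
    have h₁ : |A i| + |B i| ≤ ∑ i ∈ Finset.range N, (|A i| + |B i|) :=
      Finset.single_le_sum (f := fun i => |A i| + |B i|) (fun _ _ => by positivity)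
        (Finset.mem_range.2 hi)
    linarith [le_abs_self (A i), le_abs_self (B i)]
  set τ : ℝ := M⁻¹ with hτ
  have hτ0 : 0 < τ := inv_pos.2 hM0
  have hτM : τ * M = 1 := inv_mul_cancel₀ hM0.ne'
  have hK0 : 0 ≤ 1 - τ * (m * (2 + q)) := by
    have : m * (2 + q) ≤ M := by
      have : m * (2 + q) ≤ γ * (2 + q) := by gcongr
      linarith
    have : τ * (m * (2 + q)) ≤ τ * M := by gcongr
    linarith
  set G : (Fin (N + 1) → ℝ) → Fin (N + 1) → ℝ := fun y i =>
    if i.val = 0 ∨ i.val = N then 0 else gridExtend y i + τ * R y i with hG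
  obtain ⟨K, hK⟩ : ∃ K : NNReal, (K : ℝ) = 1 - τ * (m * (2 + q)) := ⟨⟨_, hK0⟩, rfl⟩
  have hcontr : ContractingWith K G := by
    constructor
    · rw [← NNReal.coe_lt_coe, hK, NNReal.coe_one]
      have : 0 < τ * (m * (2 + q)) := by positivity
      linarith
    · refine LipschitzWith.of_dist_le_mul fun y z => ?_
      refine (dist_pi_le_iff (by positivity)).2 fun i => ?_
      rw [Real.dist_eq, hK]
      simp only [hG]
      split_ifs with hi
      · simpa using mul_nonneg hK0 dist_nonneg
      · push Not at hi
        have hiN : i.val < N := by omega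
        obtain ⟨p₁, h₁, h₁', e₁⟩ := exists_slope_of_deriv_bounds hm (hg (i - 1) (by omega))
          (gridExtend y (i - 1)) (gridExtend z (i - 1))
        obtain ⟨p₂, h₂, h₂', e₂⟩ := exists_slope_of_deriv_bounds hm (hg i (by omega))
          (gridExtend y i) (gridExtend z i)
        obtain ⟨p₃, h₃, h₃', e₃⟩ := exists_slope_of_deriv_bounds hm (hg (i + 1) (by omega))
          (gridExtend y (i + 1)) (gridExtend z (i + 1))
        have hτi : τ * (A i + B i + q * γ) ≤ 1 := by
          rw [← hτM]
          gcongr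
          exact hMAB i hiN
        convert abs_relaxation_le hq hτ0.le (hA i hi.1 hiN) (hB i hi.1 hiN) hτi
          ⟨h₁, h₁'⟩ ⟨h₂, h₂'⟩ ⟨h₃, h₃'⟩ (abs_gridExtend_sub_le y z (i - 1))
          (abs_gridExtend_sub_le y z i) (abs_gridExtend_sub_le y z (i + 1)) using 2
        rw [← e₁, ← e₂, ← e₃, hR]
        ring
  have hfix : ∀ y : Fin (N + 1) → ℝ, Function.IsFixedPt G y ↔
      ∀ i : Fin (N + 1), if i.val = 0 ∨ i.val = N then y i = 0 else R y i = 0 := by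
    intro y
    rw [Function.IsFixedPt, funext_iff]
    refine forall_congr' fun i => ?_
    simp only [hG, gridExtend_val]
    split_ifs
    · exact eq_comm
    · simp [hτ0.ne']
  refine ⟨hcontr.fixedPoint, (hfix _).1 hcontr.fixedPoint_isFixedPt, fun y hy => ?_⟩
  exact hcontr.fixedPoint_unique ((hfix y).2 hy)

lemma one_div_tanh_sub_one_div_sinh_pos {t : ℝ} (ht : 0 < t) :
    0 < 1 / Real.tanh t - 1 / Real.sinh t := by
  have hs : 0 < Real.sinh t := Real.sinh_pos_iff.2 ht
  have hc : 1 < Real.cosh t := Real.one_lt_cosh.2 ht.ne'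
  rw [Real.tanh_eq_sinh_div_cosh, one_div_div, ← sub_div]
  exact div_pos (by linarith) hs

/-- Existence and uniqueness of the solution of the discrete problem `F ȳ = 0`. -/
theorem discrete_existence_uniqueness
    (m γ : ℝ) (hm : 0 < m) (hmγ : m ≤ γ)
    (f : ℝ → ℝ → ℝ)
    (hf : ContDiffOn ℝ 1 (Function.uncurry f) (Set.Icc 0 1 ×ˢ Set.univ))
    (hfy : ∀ x y : ℝ, x ∈ Set.Icc (0:ℝ) 1 →
      m ≤ deriv (f x) y ∧ deriv (f x) y ≤ γ)
    (N : ℕ) (hN : 2 ≤ N) (x : ℕ → ℝ)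
    (hx0 : x 0 = 0) (hxN : x N = 1)
    (hmesh : ∀ i < N, x i < x (i + 1))
    (ε : ℝ) (hε : ε ∈ Set.Ioo (0:ℝ) 1) (q : ℝ) (hq : 0 < q) :
    ∃! ybar : Fin (N + 1) → ℝ,
      schemeF N x f γ q (Real.sqrt γ / ε) ybar = 0 := by
  have hγ : 0 < γ := hm.trans_le hmγ
  set β := Real.sqrt γ / ε with hβdef
  have hβ : 0 < β := div_pos (Real.sqrt_pos.2 hγ) hε.1
  have hmono : MonotoneOn x (Set.Iic N) := by
    refine monotoneOn_of_le_succ Set.ordConnected_Iic fun k _ _ hk => (hmesh k ?_).le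
    exact Nat.lt_of_succ_le hk
  have hxmem : ∀ j ≤ N, x j ∈ Set.Icc (0 : ℝ) 1 := fun j hj =>
    ⟨hx0 ▸ hmono (Set.mem_Iic.2 (Nat.zero_le N)) hj (Nat.zero_le j),
      hxN ▸ hmono hj Set.self_mem_Iic hj⟩
  have harg : ∀ j, j ≠ 0 → j ≤ N → 0 < β * (x j - x (j - 1)) := by
    intro j hj hjN
    obtain ⟨k, rfl⟩ := Nat.exists_eq_succ_of_ne_zero hj
    exact mul_pos hβ (sub_pos.2 (hmesh k hjN))
  set a : ℕ → ℝ := fun j => 1 / Real.sinh (β * (x j - x (j - 1))) with ha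
  set d : ℕ → ℝ := fun j => 1 / Real.tanh (β * (x j - x (j - 1))) with hd
  have ha0 : ∀ j, j ≠ 0 → j ≤ N → 0 < a j := fun j hj hjN =>
    one_div_pos.2 (Real.sinh_pos_iff.2 (harg j hj hjN))
  have hΔ0 : ∀ j, j ≠ 0 → j ≤ N → 0 < d j - a j := fun j hj hjN =>
    one_div_tanh_sub_one_div_sinh_pos (harg j hj hjN)
  have hS : ∀ i, i ≠ 0 → i < N → 0 < (d i - a i) + (d (i + 1) - a (i + 1)) := fun i hi hiN =>
    add_pos (hΔ0 i hi hiN.le) (hΔ0 (i + 1) i.succ_ne_zero hiN)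
  set S : ℕ → ℝ := fun i => (d i - a i) + (d (i + 1) - a (i + 1)) with hSdef
  set A : ℕ → ℝ := fun i => γ / S i * ((q + 1) * a i + d i + (d (i + 1) - a (i + 1))) with hA
  set B : ℕ → ℝ := fun i => γ / S i * ((q + 1) * a (i + 1) + d (i + 1) + (d i - a i)) with hB
  have hle : ∀ s c : ℝ, 0 < s → s ≤ c → γ ≤ γ / s * c := by
    intro s c hs hsc
    rw [div_mul_eq_mul_div, le_div_iff₀ hs]
    gcongr
  have hAγ : ∀ i, i ≠ 0 → i < N → γ ≤ A i := by
    intro i hi hiN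
    refine hle _ _ (hS i hi hiN) ?_
    have := mul_pos (add_pos hq two_pos) (ha0 i hi hiN.le)
    simp only [hSdef]
    linarith
  have hBγ : ∀ i, i ≠ 0 → i < N → γ ≤ B i := by
    intro i hi hiN
    refine hle _ _ (hS i hi hiN) ?_
    have := mul_pos (add_pos hq two_pos) (ha0 (i + 1) i.succ_ne_zero hiN)
    simp only [hSdef]
    linarith
  refine (existsUnique_congr fun y => ?_).1 (existsUnique_threePoint (g := fun j => f (x j))
    hm hmγ hq.le (fun j hj y => hfy (x j) y (hxmem j hj)) hAγ hBγ)
  rw [funext_iff]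
  refine forall_congr' fun i => ?_
  have hF : schemeF N x f γ q β y i = if i.val = 0 then gridExtend y 0
      else if i.val = N then gridExtend y N
      else γ / S i * (((q + 1) * a i + d i + (d (i + 1) - a (i + 1)))
            * (gridExtend y (i.val - 1) - gridExtend y i)
          - ((q + 1) * a (i + 1) + d (i + 1) + (d i - a i))
            * (gridExtend y i - gridExtend y (i + 1))
          - (f (x (i.val - 1)) (gridExtend y (i.val - 1)) + q * f (x i) (gridExtend y i)
            + f (x (i + 1)) (gridExtend y (i + 1))) / γ * S i) := rfl
  rw [hF, Pi.zero_apply]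
  by_cases h0 : i.val = 0
  · rw [if_pos (Or.inl h0), if_pos h0, ← gridExtend_val y i, h0]
  by_cases h1 : i.val = N
  · rw [if_pos (Or.inr h1), if_neg h0, if_pos h1, ← gridExtend_val y i, h1]
  rw [if_neg (by tauto), if_neg h0, if_neg h1]
  have hSi : S i ≠ 0 := (hS i h0 (by omega)).ne'
  refine Eq.congr_left ?_
  simp only [hA, hB]
  field_simp
end

section
/- Under the hypotheses of the discrete scheme, for every y ∈ ℝ^{N+1} the Jacobian matrix H = H(y) of F satisfies, for each 1 ≤ i ≤ N−1: H_{i,i} < 0, H_{i,i−1} > 0, H_{i,i+1} > 0, and the strict diagonal dominance estimate |H_{i,i}| − |H_{i,i−1}| − |H_{i,i+1}| ≥ (q+2)m. -/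
/-- The Jacobian (Fréchet derivative) matrix `H(y)` of the discrete operator `F` of the
fitted difference scheme on an arbitrary mesh, with `β = √γ/ε`, `aᵢ = 1/sinh(β h_{i-1})`,
`dᵢ = 1/tanh(β h_{i-1})`, `Δdᵢ = dᵢ - aᵢ`, and `∂f/∂y` the partial derivative of `f` in
its second variable. -/
noncomputable def schemeH (N : ℕ) (x : ℕ → ℝ) (f : ℝ → ℝ → ℝ) (γ q β : ℝ)
    (y : Fin (N + 1) → ℝ) : Matrix (Fin (N + 1)) (Fin (N + 1)) ℝ := fun i j =>
  let Y : ℕ → ℝ := fun k => if h : k < N + 1 then y ⟨k, h⟩ else 0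
  let a : ℕ → ℝ := fun k => 1 / Real.sinh (β * (x k - x (k - 1)))
  let d : ℕ → ℝ := fun k => 1 / Real.tanh (β * (x k - x (k - 1)))
  let Δd : ℕ → ℝ := fun k => d k - a k
  let fy : ℕ → ℝ := fun k => deriv (f (x k)) (Y k)
  if i.val = 0 ∨ i.val = N then (if j = i then 1 else 0)
  else if j.val = i.val then
    γ / (Δd i.val + Δd (i.val + 1)) *
      (-(q * (a i.val + a (i.val + 1))) - 2 * (d i.val + d (i.val + 1))
        - q / γ * fy i.val * (Δd i.val + Δd (i.val + 1)))
  else if j.val + 1 = i.val then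
    γ / (Δd i.val + Δd (i.val + 1)) *
      ((Δd i.val + Δd (i.val + 1)) * (1 - fy (i.val - 1) / γ) + (q + 2) * a i.val)
  else if j.val = i.val + 1 then
    γ / (Δd i.val + Δd (i.val + 1)) *
      ((Δd i.val + Δd (i.val + 1)) * (1 - fy (i.val + 1) / γ) + (q + 2) * a (i.val + 1))
  else 0

theorem inv_sinh_pos_and_lt_inv_tanh {t : ℝ} (ht : 0 < t) :
    0 < 1 / Real.sinh t ∧ 1 / Real.sinh t < 1 / Real.tanh t := by
  have hs : 0 < Real.sinh t := Real.sinh_pos_iff.mpr ht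
  refine ⟨one_div_pos.mpr hs, ?_⟩
  rw [Real.tanh_eq_sinh_div_cosh, one_div_div]
  exact div_lt_div_of_pos_right (Real.one_lt_cosh.mpr ht.ne') hs

theorem mem_Icc_of_mesh {N : ℕ} {x : ℕ → ℝ} (hx0 : x 0 = 0) (hxN : x N = 1)
    (hmesh : ∀ i < N, x i < x (i + 1)) {k : ℕ} (hk : k ≤ N) : x k ∈ Set.Icc (0 : ℝ) 1 := by
  have hmono : MonotoneOn x (Set.Iic N) :=
    monotoneOn_of_le_succ Set.ordConnected_Iic fun i _ _ hi =>
      (hmesh i (Nat.lt_of_succ_le hi)).le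
  constructor
  · simpa only [hx0] using hmono (Nat.zero_le N) hk (Nat.zero_le k)
  · simpa only [hxN] using hmono hk (Set.mem_Iic.mpr le_rfl) hk

/-- The sign pattern and the diagonal dominance of a row of the scheme, as a statement about
its coefficients. -/
theorem row_sign_and_dominance {m γ q a a' d d' u v w : ℝ} (hγ : 0 < γ) (hm : 0 < m) (hq : 0 < q)
    (ha : 0 < a) (ha' : 0 < a') (had : a < d) (had' : a' < d')
    (hu : m ≤ u) (hv : m ≤ v) (hw : m ≤ w) (huγ : u ≤ γ) (hwγ : w ≤ γ) :
    let D := d - a + (d' - a')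
    let C := γ / D * (-(q * (a + a')) - 2 * (d + d') - q / γ * v * D)
    let L := γ / D * (D * (1 - u / γ) + (q + 2) * a)
    let R := γ / D * (D * (1 - w / γ) + (q + 2) * a')
    C < 0 ∧ 0 < L ∧ 0 < R ∧ (q + 2) * m ≤ |C| - |L| - |R| := by
  intro D C L R
  have hD : 0 < D := by simp only [D]; linarith
  have hγD : 0 < γ / D := div_pos hγ hD
  have hC : C < 0 := by
    have h₁ : 0 < q * (a + a') := by positivity
    have h₂ : 0 < q / γ * v * D := mul_pos (mul_pos (div_pos hq hγ) (hm.trans_le hv)) hD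
    exact mul_neg_of_pos_of_neg hγD (by linarith)
  have off_diag_pos : ∀ {s b : ℝ}, s ≤ γ → 0 < b →
      0 < γ / D * (D * (1 - s / γ) + (q + 2) * b) := fun hs hb =>
    mul_pos hγD (add_pos_of_nonneg_of_pos
      (mul_nonneg hD.le (sub_nonneg.mpr ((div_le_one hγ).mpr hs))) (by positivity))
  have hL : 0 < L := off_diag_pos huγ ha
  have hR : 0 < R := off_diag_pos hwγ ha'
  refine ⟨hC, hL, hR, ?_⟩
  rw [abs_of_neg hC, abs_of_pos hL, abs_of_pos hR]
  have key : -C - L - R = q * v + u + w := by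
    have hsum : d + d' = D + (a + a') := by simp only [D]; ring
    simp only [C, L, R, hsum]
    field_simp
    ring
  rw [key]
  nlinarith [mul_le_mul_of_nonneg_left hv hq.le]

/-- Sign pattern and strict diagonal dominance of the Jacobian of the scheme. -/
theorem jacobian_sign_and_dominance
    (m γ : ℝ) (hm : 0 < m) (hmγ : m ≤ γ)
    (f : ℝ → ℝ → ℝ)
    (hf : ContDiffOn ℝ 1 (Function.uncurry f) (Set.Icc 0 1 ×ˢ Set.univ))
    (hfy : ∀ x y : ℝ, x ∈ Set.Icc (0:ℝ) 1 →
      m ≤ deriv (f x) y ∧ deriv (f x) y ≤ γ)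
    (N : ℕ) (hN : 2 ≤ N) (x : ℕ → ℝ)
    (hx0 : x 0 = 0) (hxN : x N = 1)
    (hmesh : ∀ i < N, x i < x (i + 1))
    (ε : ℝ) (hε : ε ∈ Set.Ioo (0:ℝ) 1) (q : ℝ) (hq : 0 < q)
    (y : Fin (N + 1) → ℝ) :
    ∀ i : ℕ, ∀ hi1 : 1 ≤ i, ∀ hi2 : i ≤ N - 1,
      let H := schemeH N x f γ q (Real.sqrt γ / ε) y
      H ⟨i, by omega⟩ ⟨i, by omega⟩ < 0 ∧
      0 < H ⟨i, by omega⟩ ⟨i - 1, by omega⟩ ∧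
      0 < H ⟨i, by omega⟩ ⟨i + 1, by omega⟩ ∧
      (q + 2) * m ≤
        |H ⟨i, by omega⟩ ⟨i, by omega⟩| - |H ⟨i, by omega⟩ ⟨i - 1, by omega⟩|
          - |H ⟨i, by omega⟩ ⟨i + 1, by omega⟩| := by
  intro i hi1 hi2 H
  obtain ⟨k, rfl⟩ : ∃ k, i = k + 1 := ⟨i - 1, by omega⟩
  have hγ : 0 < γ := hm.trans_le hmγ
  have hβ : 0 < Real.sqrt γ / ε := div_pos (Real.sqrt_pos.mpr hγ) hε.1
  have step : ∀ j < N, 0 < Real.sqrt γ / ε * (x (j + 1) - x j) := fun j hj =>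
    mul_pos hβ (sub_pos.mpr (hmesh j hj))
  obtain ⟨ha, had⟩ := inv_sinh_pos_and_lt_inv_tanh (step k (by omega))
  obtain ⟨ha', had'⟩ := inv_sinh_pos_and_lt_inv_tanh (step (k + 1) (by omega))
  have hderiv : ∀ j ≤ N, ∀ t, m ≤ deriv (f (x j)) t ∧ deriv (f (x j)) t ≤ γ := fun j hj t =>
    hfy (x j) t (mem_Icc_of_mesh hx0 hxN hmesh hj)
  have hu := hderiv k (by omega) (y ⟨k, by omega⟩)
  have hv := hderiv (k + 1) (by omega) (y ⟨k + 1, by omega⟩)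
  have hw := hderiv (k + 1 + 1) (by omega) (y ⟨k + 1 + 1, by omega⟩)
  have hk : k + 1 ≠ N := by omega
  have hk0 : k < N + 1 := by omega
  have hkk : k + 1 + 1 ≠ k := by omega
  have hk1 : k < N := by omega
  have hk2 : k + 1 < N := by omega
  have row := row_sign_and_dominance hγ hm hq ha ha' had had' hu.1 hv.1 hw.1 hu.2 hw.2
  simpa [H, schemeH, hk, hkk, hk0, hk1, hk2] using row
end

section
/- There exists a constant C > 0, depending only on a, p and ε* (and not on N or ε), such that for every ε ∈ (0, ε*], every even N ≥ 4 and every 0 ≤ i ≤ N−1, the steps of the Bakhvalov-type mesh satisfy hᵢ ≤ C/N. -/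
/-- The boundary-layer part `κ(t) = aεt/(p-t)` of the Bakhvalov-type mesh generating
function. -/
noncomputable def bkappa (a ε p : ℝ) (t : ℝ) : ℝ := a * ε * t / (p - t)

/-- The coefficient `ω` of the cubic part, determined by `π(1/2) = 1/2`, where
`α = p - ε^{1/3}`. -/
noncomputable def bomega (a ε p : ℝ) : ℝ :=
  (1 / 2 - (p - ε ^ ((1:ℝ)/3)))⁻¹ ^ 3 *
    (1 / 2 - a * (p * (1 / 2 - (p - ε ^ ((1:ℝ)/3))) ^ 2
      + p * (1 / 2 - (p - ε ^ ((1:ℝ)/3))) * ε ^ ((1:ℝ)/3)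
      + (p - ε ^ ((1:ℝ)/3)) * ε ^ ((2:ℝ)/3)))

/-- The cubic part `π(t) = ω(t-α)³ + κ''(α)(t-α)²/2 + κ'(α)(t-α) + κ(α)`, with
`α = p - ε^{1/3}`, `κ'(α) = aεp/(p-α)²`, `κ''(α) = 2aεp/(p-α)³`. -/
noncomputable def bpi (a ε p : ℝ) (t : ℝ) : ℝ :=
  bomega a ε p * (t - (p - ε ^ ((1:ℝ)/3))) ^ 3
    + (2 * a * ε * p / (p - (p - ε ^ ((1:ℝ)/3))) ^ 3) * (t - (p - ε ^ ((1:ℝ)/3))) ^ 2 / 2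
    + (a * ε * p / (p - (p - ε ^ ((1:ℝ)/3))) ^ 2) * (t - (p - ε ^ ((1:ℝ)/3)))
    + bkappa a ε p (p - ε ^ ((1:ℝ)/3))

/-- The Bakhvalov-type mesh generating function: `φ = κ` on `[0, α]`, `φ = π` on
`[α, 1/2]`, and `φ(t) = 1 - φ(1-t)` on `[1/2, 1]`. -/
noncomputable def bphi (a ε p : ℝ) (t : ℝ) : ℝ :=
  if t ≤ 1 / 2 then
    (if t ≤ p - ε ^ ((1:ℝ)/3) then bkappa a ε p t else bpi a ε p t)
  else
    1 - (if 1 - t ≤ p - ε ^ ((1:ℝ)/3) then bkappa a ε p (1 - t) else bpi a ε p (1 - t))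

/-- The left half of `bphi`, as a function of `s = ε^{1/3}` and a generic coefficient `w` of the
cubic term. -/
noncomputable def bakhvalovLeft (a p s w t : ℝ) : ℝ :=
  if t ≤ p - s then a * s ^ 3 * t / (p - t)
  else w * (t - (p - s)) ^ 3 + a * p * (t - (p - s)) ^ 2 + a * s * p * (t - (p - s))
    + a * s ^ 2 * (p - s)

lemma bakhvalovLeft_rational_step {a p s x y : ℝ} (ha : 0 < a) (hs : 0 < s) (hsp : s < p)
    (hp : p < 1 / 2) (hxy : x ≤ y) (hy : y ≤ p - s) :
    a * s ^ 3 * y / (p - y) - a * s ^ 3 * x / (p - x) ≤ a * (y - x) := by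
  have h1 : s ≤ p - y := by linarith
  have h2 : s ≤ p - x := by linarith
  have h1' : 0 < p - y := by linarith
  have h2' : 0 < p - x := by linarith
  have e : a * s ^ 3 * y / (p - y) - a * s ^ 3 * x / (p - x)
      = (a * (y - x)) * (s * p * (s * s / ((p - y) * (p - x)))) := by
    field_simp
    ring
  have h3 : s * s / ((p - y) * (p - x)) ≤ 1 := by
    rw [div_le_one (by positivity)]
    gcongr
  have h3' : 0 ≤ s * s / ((p - y) * (p - x)) := by positivity
  have h4 : s * p ≤ 1 := by nlinarith
  rw [e]
  exact mul_le_of_le_one_right (mul_nonneg ha.le (by linarith)) (mul_le_one₀ h4 h3' h3)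

lemma bakhvalovLeft_cubic_step {a p s w u v : ℝ} (ha : 0 < a) (hs : 0 < s) (hsp : s < p)
    (hp : p < 1 / 2) (hw : 0 ≤ w) (hu : 0 ≤ u) (huv : u ≤ v) (hv : v ≤ 1) :
    (w * v ^ 3 + a * p * v ^ 2 + a * s * p * v) - (w * u ^ 3 + a * p * u ^ 2 + a * s * p * u)
      ≤ (3 * w + 3 * a) * (v - u) := by
  have h1 : v ^ 2 + u * v + u ^ 2 ≤ 3 := by nlinarith
  have h2 : p * (v + u) ≤ 2 := by nlinarith
  have h3 : s * p ≤ 1 := by nlinarith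
  have h : w * (v ^ 2 + u * v + u ^ 2) + a * (p * (v + u)) + a * (s * p) ≤ 3 * w + 3 * a := by
    have := mul_le_mul_of_nonneg_left h1 hw
    have := mul_le_mul_of_nonneg_left h2 ha.le
    have := mul_le_mul_of_nonneg_left h3 ha.le
    linarith
  have := mul_le_mul_of_nonneg_right h (sub_nonneg.2 huv)
  linarith

lemma bakhvalovLeft_step {a p s w x y : ℝ} (ha : 0 < a) (hs : 0 < s) (hsp : s < p)
    (hp : p < 1 / 2) (hw : 0 ≤ w) (hxy : x ≤ y) (hy : y ≤ 1 / 2) :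
    bakhvalovLeft a p s w y - bakhvalovLeft a p s w x ≤ (3 * w + 3 * a) * (y - x) := by
  have key : a * s ^ 3 * (p - s) / (p - (p - s)) = a * s ^ 2 * (p - s) := by
    rw [sub_sub_cancel]
    field_simp
  unfold bakhvalovLeft
  split_ifs with h1 h2 h2
  · refine (bakhvalovLeft_rational_step ha hs hsp hp hxy h1).trans ?_
    gcongr
    · linarith
  · linarith
  · have hc := bakhvalovLeft_cubic_step (u := 0) (v := y - (p - s)) ha hs hsp hp hw le_rfl
      (by linarith) (by linarith)
    have hr := bakhvalovLeft_rational_step ha hs hsp hp h2 le_rfl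
    rw [key] at hr
    have : a * (p - s - x) ≤ (3 * w + 3 * a) * (p - s - x) := by
      gcongr
      · linarith
    linarith
  · have hc := bakhvalovLeft_cubic_step (u := x - (p - s)) (v := y - (p - s)) ha hs hsp hp hw
      (by linarith) (by linarith) (by linarith)
    linarith

lemma reflect_step_le {g : ℝ → ℝ} {L x y : ℝ} (hg : ∀ x y, x ≤ y → y ≤ 1 / 2 →
    g y - g x ≤ L * (y - x)) (hhalf : g (1 / 2) = 1 / 2) (hxy : x ≤ y) :
    (if y ≤ 1 / 2 then g y else 1 - g (1 - y)) - (if x ≤ 1 / 2 then g x else 1 - g (1 - x))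
      ≤ L * (y - x) := by
  split_ifs with h1 h2 h2
  · exact hg x y hxy h1
  · linarith
  · have := hg x (1 / 2) h2 le_rfl
    have := hg (1 - y) (1 / 2) (by linarith) le_rfl
    linarith
  · have := hg (1 - y) (1 - x) (by linarith) (by linarith)
    linarith

lemma bomega_le {a ε p : ℝ} (ha : 0 < a) (hε : 0 < ε) (hεp : ε ^ ((1:ℝ)/3) < p)
    (hp : p < 1 / 2) : bomega a ε p ≤ (1 / 2 - p)⁻¹ ^ 3 := by
  have hs : 0 < ε ^ ((1:ℝ)/3) := by positivity
  have hs2 : 0 < ε ^ ((2:ℝ)/3) := by positivity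
  unfold bomega
  generalize ε ^ ((1:ℝ)/3) = s at *
  have hα : 0 < p - s := by linarith
  have hβ : 0 < 1 / 2 - (p - s) := by linarith
  have hq : 0 < 1 / 2 - p := by linarith
  have hp0 : 0 < p := by linarith
  have hpos : 0 < a * (p * (1 / 2 - (p - s)) ^ 2 + p * (1 / 2 - (p - s)) * s
      + (p - s) * ε ^ ((2:ℝ)/3)) := by positivity
  calc _ ≤ (1 / 2 - (p - s))⁻¹ ^ 3 * 1 := by
        gcongr
        linarith
    _ ≤ (1 / 2 - p)⁻¹ ^ 3 := by
        rw [mul_one]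
        gcongr
        linarith

lemma rpow_third_pow_three {ε : ℝ} (hε : 0 < ε) : (ε ^ ((1:ℝ)/3)) ^ 3 = ε := by
  rw [← Real.rpow_natCast, ← Real.rpow_mul hε.le]
  norm_num

lemma rpow_third_sq {ε : ℝ} (hε : 0 < ε) : (ε ^ ((1:ℝ)/3)) ^ 2 = ε ^ ((2:ℝ)/3) := by
  rw [← Real.rpow_natCast, ← Real.rpow_mul hε.le]
  norm_num

lemma bakhvalovLeft_eq {a ε p : ℝ} (hε : 0 < ε) (t : ℝ) :
    bakhvalovLeft a p (ε ^ ((1:ℝ)/3)) (bomega a ε p) t =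
      if t ≤ p - ε ^ ((1:ℝ)/3) then bkappa a ε p t else bpi a ε p t := by
  have hs : 0 < ε ^ ((1:ℝ)/3) := by positivity
  have h3 := rpow_third_pow_three hε
  unfold bakhvalovLeft bpi bkappa
  generalize bomega a ε p = w
  generalize ε ^ ((1:ℝ)/3) = s at *
  subst h3
  split_ifs
  · rfl
  · rw [sub_sub_cancel]
    field_simp

lemma bakhvalovLeft_half {a ε p : ℝ} (hε : 0 < ε) (hp : p < 1 / 2) :
    bakhvalovLeft a p (ε ^ ((1:ℝ)/3)) (bomega a ε p) (1 / 2) = 1 / 2 := by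
  have hs : 0 < ε ^ ((1:ℝ)/3) := by positivity
  unfold bakhvalovLeft bomega
  rw [← rpow_third_sq hε]
  generalize ε ^ ((1:ℝ)/3) = s at *
  have hβ : 0 < 1 / 2 - (p - s) := by linarith
  rw [if_neg (by linarith)]
  have hinv : (1 / 2 - (p - s))⁻¹ ^ 3 * (1 / 2 - (p - s)) ^ 3 = 1 := by
    rw [← mul_pow, inv_mul_cancel₀ hβ.ne', one_pow]
  linear_combination (1 / 2 - a * (p * (1 / 2 - (p - s)) ^ 2 + p * (1 / 2 - (p - s)) * s
      + (p - s) * s ^ 2)) * hinv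

/-- The steps of the Bakhvalov-type mesh satisfy `hᵢ ≤ C/N` with `C` independent of `N`
and `ε`. -/
theorem bakhvalov_step_upper_bound
    (εstar p a : ℝ)
    (hεstar : εstar ∈ Set.Ioo (0:ℝ) (1/8))
    (hp : p ∈ Set.Ioo (εstar ^ ((1:ℝ)/3)) (1/2))
    (ha : 0 < a)
    (hω : ∀ ε ∈ Set.Ioc (0:ℝ) εstar, 0 ≤ bomega a ε p) :
    ∃ C > 0, ∀ ε ∈ Set.Ioc (0:ℝ) εstar, ∀ N : ℕ, Even N → 4 ≤ N →
      ∀ i < N,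
        bphi a ε p (((i:ℝ) + 1) / N) - bphi a ε p ((i:ℝ) / N) ≤ C / N := by
  have hq : 0 < 1 / 2 - p := sub_pos.2 hp.2
  refine ⟨3 * (1 / 2 - p)⁻¹ ^ 3 + 3 * a, by positivity, ?_⟩
  intro ε hε N _ hN i _
  have hN0 : (0:ℝ) < N := by exact_mod_cast (by omega : 0 < N)
  have hs : 0 < ε ^ ((1:ℝ)/3) := Real.rpow_pos_of_pos hε.1 _
  have hsp : ε ^ ((1:ℝ)/3) < p :=
    (Real.rpow_le_rpow hε.1.le hε.2 (by norm_num)).trans_lt hp.1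
  have hxy : (i:ℝ) / N ≤ ((i:ℝ) + 1) / N := by
    gcongr
    linarith
  have hstep := reflect_step_le
    (fun x y h h' => bakhvalovLeft_step ha hs hsp hp.2 (hω ε hε) h h')
    (bakhvalovLeft_half hε.1 hp.2) hxy
  simp only [bakhvalovLeft_eq hε.1] at hstep
  refine hstep.trans ?_
  have hwidth : ((i:ℝ) + 1) / N - (i:ℝ) / N = 1 / N := by ring
  rw [hwidth, mul_one_div]
  gcongr
  exact bomega_le ha hε.1 hsp hp.2
end

section
/- There exists a constant C > 0, depending only on a, p and ε* (and not on N or ε), such that for every ε ∈ (0, ε*], every even N ≥ 4 and every 1 ≤ i ≤ N−1, the steps of the Bakhvalov-type mesh satisfy |hᵢ − h_{i−1}| ≤ C/N². -/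
theorem hasDerivAt_ite_le {f g f' g' : ℝ → ℝ} {c : ℝ}
    (hf : ∀ t ≤ c, HasDerivAt f (f' t) t) (hg : ∀ t, c ≤ t → HasDerivAt g (g' t) t)
    (h0 : f c = g c) (h1 : f' c = g' c) (t : ℝ) :
    HasDerivAt (fun s => if s ≤ c then f s else g s) (if t ≤ c then f' t else g' t) t := by
  rcases lt_trichotomy t c with h | rfl | h
  · rw [if_pos h.le]
    refine (hf t h.le).congr_of_eventuallyEq ?_
    filter_upwards [Iio_mem_nhds h] with s hs
    exact if_pos (le_of_lt hs)
  · rw [if_pos le_rfl]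
    have hl : HasDerivWithinAt (fun s => if s ≤ t then f s else g s) (f' t) (Set.Iic t) t :=
      (hf t le_rfl).hasDerivWithinAt.congr (fun s hs => if_pos hs) (if_pos le_rfl)
    have hr : HasDerivWithinAt (fun s => if s ≤ t then f s else g s) (f' t) (Set.Ici t) t := by
      rw [h1]
      refine (hg t le_rfl).hasDerivWithinAt.congr (fun s hs => ?_) ((if_pos le_rfl).trans h0)
      rcases eq_or_lt_of_le (Set.mem_Ici.1 hs) with rfl | hs
      · exact (if_pos le_rfl).trans h0
      · exact if_neg (not_le.2 hs)
    simpa [Set.Iic_union_Ici] using hl.union hr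
  · rw [if_neg (not_le.2 h)]
    refine (hg t h.le).congr_of_eventuallyEq ?_
    filter_upwards [Ioi_mem_nhds h] with s hs
    exact if_neg (not_le.2 hs)

theorem abs_sub_le_of_ite_le {f g : ℝ → ℝ} {c d M : ℝ} (h0 : f c = g c) (hcd : c ≤ d)
    (hf : ∀ x ≤ c, ∀ y ≤ c, |f y - f x| ≤ M * |y - x|)
    (hg : ∀ x ∈ Set.Icc c d, ∀ y ∈ Set.Icc c d, |g y - g x| ≤ M * |y - x|) :
    ∀ x ≤ d, ∀ y ≤ d, |(if y ≤ c then f y else g y) - (if x ≤ c then f x else g x)|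
      ≤ M * |y - x| := by
  have key : ∀ x ≤ c, ∀ y, c ≤ y → y ≤ d → |g y - f x| ≤ M * |y - x| := by
    intro x hx y hy hyd
    have h1 := hf x hx c le_rfl
    have h2 := hg c ⟨le_rfl, hcd⟩ y ⟨hy, hyd⟩
    rw [abs_of_nonneg (sub_nonneg.2 hx)] at h1
    rw [abs_of_nonneg (sub_nonneg.2 hy)] at h2
    rw [abs_of_nonneg (sub_nonneg.2 (hx.trans hy))]
    have h3 := abs_add_le (g y - g c) (f c - f x)
    rw [show g y - g c + (f c - f x) = g y - f x by rw [h0]; ring] at h3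
    linarith
  intro x hx y hy
  split_ifs with h1 h2 h2
  · exact hf x h2 y h1
  · rw [abs_sub_comm, abs_sub_comm y]
    exact key y h1 x (not_le.1 h2).le hx
  · exact key x h2 y (not_le.1 h1).le hy
  · exact hg x ⟨(not_le.1 h2).le, hx⟩ y ⟨(not_le.1 h1).le, hy⟩

theorem abs_second_difference_le {f f' : ℝ → ℝ} {M x h : ℝ} (hh : 0 ≤ h)
    (hM : 0 ≤ M) (hf : ∀ t, HasDerivAt f (f' t) t) (hL : ∀ x y, |f' y - f' x| ≤ M * |y - x|) :
    |(f (x + h) - f x) - (f x - f (x - h))| ≤ 2 * M * h ^ 2 := by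
  have hd : ∀ s ∈ Set.Icc 0 h, HasDerivWithinAt (fun s => f (x + s) + f (x - s))
      (f' (x + s) - f' (x - s)) (Set.Icc 0 h) s := by
    intro s _
    have h1 := (hf (x + s)).comp_const_add x s
    have h2 := (hf (x - s)).comp_const_sub x s
    exact (h1.add h2).hasDerivWithinAt
  have hb : ∀ s ∈ Set.Icc 0 h, ‖f' (x + s) - f' (x - s)‖ ≤ 2 * M * h := by
    intro s hs
    have h1 := hL (x - s) (x + s)
    have h2 : 0 ≤ 2 * s := mul_nonneg zero_le_two hs.1
    rw [show x + s - (x - s) = 2 * s by ring, abs_of_nonneg h2] at h1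
    rw [Real.norm_eq_abs]
    linarith [mul_le_mul_of_nonneg_left hs.2 hM]
  have := (convex_Icc 0 h).norm_image_sub_le_of_norm_hasDerivWithin_le hd hb
    (Set.left_mem_Icc.2 hh) (Set.right_mem_Icc.2 hh)
  simp only [Real.norm_eq_abs, add_zero, sub_zero, abs_of_nonneg hh] at this
  calc _ = |f (x + h) + f (x - h) - (f x + f x)| := by congr 1; ring
    _ ≤ _ := this
    _ = _ := by ring

theorem abs_sub_le_of_hasDerivAt {f f' : ℝ → ℝ} {S : Set ℝ} {M : ℝ} (hS : Convex ℝ S)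
    (hf : ∀ t ∈ S, HasDerivAt f (f' t) t) (hM : ∀ t ∈ S, |f' t| ≤ M) :
    ∀ x ∈ S, ∀ y ∈ S, |f y - f x| ≤ M * |y - x| := fun _ hx _ hy =>
  hS.norm_image_sub_le_of_norm_hasDerivWithin_le
    (fun t ht => (hf t ht).hasDerivWithinAt) hM hx hy

/-- The mesh generating function has a globally Lipschitz derivative, with a constant that does
not depend on `ε`. -/
theorem bphi_exists_lipschitz_deriv {ε p a : ℝ} (hε : 0 < ε) (hεp : ε ^ ((1:ℝ)/3) < p)
    (hp : p < 1 / 2) (ha : 0 < a) (hω : 0 ≤ bomega a ε p) :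
    ∃ f' : ℝ → ℝ, (∀ t, HasDerivAt (bphi a ε p) (f' t) t) ∧
      ∀ x y, |f' y - f' x| ≤ (2 * a * p + 3 * (1 / 2 - p)⁻¹ ^ 3) * |y - x| := by
  have hq : 0 < ε ^ ((1:ℝ)/3) := Real.rpow_pos_of_pos hε _
  have hε3 : ε = (ε ^ ((1:ℝ)/3)) ^ 3 := by
    rw [← Real.rpow_natCast, ← Real.rpow_mul hε.le]; norm_num
  have hε2 : ε ^ ((2:ℝ)/3) = (ε ^ ((1:ℝ)/3)) ^ 2 := by
    rw [← Real.rpow_natCast, ← Real.rpow_mul hε.le]; norm_num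
  set q := ε ^ ((1:ℝ)/3) with hqdef
  have hp0 : 0 < p := hq.trans hεp
  have hr : 0 < 1 / 2 - p := by linarith
  have hs : 0 < 1 / 2 - (p - q) := by linarith
  set w := bomega a ε p with hw
  have hweq : w * (1 / 2 - (p - q)) ^ 3 = 1 / 2 - a * (p * (1 / 2 - (p - q)) ^ 2
      + p * (1 / 2 - (p - q)) * q + (p - q) * q ^ 2) := by
    rw [hw, bomega, ← hqdef, hε2, inv_pow, mul_right_comm, inv_mul_cancel₀ (pow_pos hs 3).ne',
      one_mul]
  have hwle : w ≤ (1 / 2 - p)⁻¹ ^ 3 := by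
    have h1 : w * (1 / 2 - (p - q)) ^ 3 ≤ 1 := by
      rw [hweq]
      have : 0 ≤ a * (p * (1 / 2 - (p - q)) ^ 2
        + p * (1 / 2 - (p - q)) * q + (p - q) * q ^ 2) := by
        have : 0 < p - q := by linarith
        positivity
      linarith
    have h2 : w * (1 / 2 - p) ^ 3 ≤ w * (1 / 2 - (p - q)) ^ 3 := by
      gcongr; linarith
    rw [inv_pow, ← one_div, le_div_iff₀ (by positivity)]
    exact h2.trans h1
  set M := 2 * a * p + 3 * (1 / 2 - p)⁻¹ ^ 3 with hM
  have hpi : ∀ t, bpi a ε p t = w * (t - (p - q)) ^ 3 + a * p * (t - (p - q)) ^ 2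
      + a * p * q * (t - (p - q)) + a * q ^ 2 * (p - q) := by
    intro t
    rw [bpi, bkappa, ← hqdef, ← hw, sub_sub_cancel, hε3]
    field_simp
  have hpi_half : bpi a ε p (1 / 2) = 1 / 2 := by
    rw [hpi, hweq]; ring
  let k' : ℝ → ℝ := fun t => a * ε * p / (p - t) ^ 2
  let g' : ℝ → ℝ := fun t => 3 * w * (t - (p - q)) ^ 2 + 2 * a * p * (t - (p - q)) + a * p * q
  have hk1 : ∀ t ≤ p - q, HasDerivAt (bkappa a ε p) (k' t) t := by
    intro t ht
    have hne : p - t ≠ 0 := by linarith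
    have := ((hasDerivAt_id t).const_mul (a * ε)).div ((hasDerivAt_id t).const_sub p) hne
    refine this.congr_deriv ?_
    simp only [k', id]
    field_simp
    ring
  have hk2 : ∀ t ≤ p - q, HasDerivAt k' (2 * a * ε * p / (p - t) ^ 3) t := by
    intro t ht
    have hne : p - t ≠ 0 := by linarith
    have := (hasDerivAt_const t (a * ε * p)).div (((hasDerivAt_id t).const_sub p).pow 2)
      (pow_ne_zero 2 hne)
    refine this.congr_deriv ?_
    simp only [id, Pi.pow_apply]
    field_simp
    ring
  have hlin : ∀ t : ℝ, HasDerivAt (fun t => t - (p - q)) 1 t := fun t =>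
    (hasDerivAt_id t).sub_const _
  have hg1 : ∀ t, HasDerivAt (bpi a ε p) (g' t) t := by
    intro t
    rw [show bpi a ε p = _ from funext hpi]
    have := (((((hlin t).pow 3).const_mul w).add (((hlin t).pow 2).const_mul (a * p))).add
      ((hlin t).const_mul (a * p * q))).add_const (a * q ^ 2 * (p - q))
    refine this.congr_deriv ?_
    simp only [g']
    norm_num
    ring
  have hg2 : ∀ t, HasDerivAt g' (6 * w * (t - (p - q)) + 2 * a * p) t := by
    intro t
    have := ((((hlin t).pow 2).const_mul (3 * w)).add
      ((hlin t).const_mul (2 * a * p))).add_const (a * p * q)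
    refine this.congr_deriv ?_
    norm_num
    ring
  have hkg0 : bkappa a ε p (p - q) = bpi a ε p (p - q) := by
    rw [hpi, bkappa, sub_sub_cancel, hε3]
    field_simp
    ring
  have hkg1 : k' (p - q) = g' (p - q) := by
    simp only [k', g', sub_sub_cancel, sub_self]
    rw [hε3]
    field_simp
    ring
  have hkL : ∀ x ≤ p - q, ∀ y ≤ p - q, |k' y - k' x| ≤ M * |y - x| := by
    refine abs_sub_le_of_hasDerivAt (convex_Iic (p - q)) hk2 fun t ht => ?_
    have ht' : q ≤ p - t := by linarith [Set.mem_Iic.1 ht]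
    have h0 : 0 < p - t := hq.trans_le ht'
    rw [abs_of_nonneg (by positivity), div_le_iff₀ (by positivity)]
    have h3 : ε ≤ (p - t) ^ 3 := by rw [hε3]; gcongr
    calc 2 * a * ε * p = 2 * a * p * ε := by ring
      _ ≤ M * (p - t) ^ 3 := by
        gcongr
        rw [hM]
        have : 0 < 3 * (1 / 2 - p)⁻¹ ^ 3 := by positivity
        linarith
  have hgL : ∀ x ∈ Set.Icc (p - q) (1 / 2), ∀ y ∈ Set.Icc (p - q) (1 / 2),
      |g' y - g' x| ≤ M * |y - x| := by
    refine abs_sub_le_of_hasDerivAt (convex_Icc _ _) (fun t _ => hg2 t) fun t ht => ?_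
    have h0 : 0 ≤ t - (p - q) := sub_nonneg.2 ht.1
    rw [abs_of_nonneg (by positivity)]
    have h1 : w * (t - (p - q)) ≤ (1 / 2 - p)⁻¹ ^ 3 * (1 / 2) := by
      gcongr
      linarith [ht.2]
    rw [hM]
    linarith
  let L : ℝ → ℝ := fun t => if t ≤ p - q then bkappa a ε p t else bpi a ε p t
  let L' : ℝ → ℝ := fun t => if t ≤ p - q then k' t else g' t
  have hL1 : ∀ t, HasDerivAt L (L' t) t :=
    hasDerivAt_ite_le hk1 (fun t _ => hg1 t) hkg0 hkg1
  have hLL : ∀ x ≤ 1 / 2, ∀ y ≤ 1 / 2, |L' y - L' x| ≤ M * |y - x| :=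
    abs_sub_le_of_ite_le hkg1 (by linarith) hkL hgL
  have hR1 : ∀ t, HasDerivAt (fun t => 1 - L (1 - t)) (L' (1 - t)) t := by
    intro t
    simpa using ((hL1 (1 - t)).comp_const_sub 1 t).const_sub 1
  have hL_half : L (1 / 2) = 1 / 2 := by
    simp only [L]
    rw [if_neg (by linarith), hpi_half]
  refine ⟨fun t => if t ≤ 1 / 2 then L' t else L' (1 - t),
    hasDerivAt_ite_le (f := L) (g := fun t => 1 - L (1 - t)) (fun t _ => hL1 t)
      (fun t _ => hR1 t) ?_ ?_, fun x y => ?_⟩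
  · norm_num at hL_half ⊢
    linarith
  · norm_num
  · refine abs_sub_le_of_ite_le (g := fun t => L' (1 - t)) (d := max (1 / 2) (max x y)) ?_
      (le_max_left _ _) hLL (fun x hx y hy => ?_) x (by simp) y (by simp)
    · norm_num
    · have := hLL (1 - x) (by linarith [hx.1]) (1 - y) (by linarith [hy.1])
      rwa [show 1 - y - (1 - x) = x - y by ring, abs_sub_comm x y] at this

/-- The steps of the Bakhvalov-type mesh satisfy `|hᵢ - h_{i-1}| ≤ C/N²` with `C`
independent of `N` and `ε`. -/
theorem bakhvalov_step_difference_bound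
    (εstar p a : ℝ)
    (hεstar : εstar ∈ Set.Ioo (0:ℝ) (1/8))
    (hp : p ∈ Set.Ioo (εstar ^ ((1:ℝ)/3)) (1/2))
    (ha : 0 < a)
    (hω : ∀ ε ∈ Set.Ioc (0:ℝ) εstar, 0 ≤ bomega a ε p) :
    ∃ C > 0, ∀ ε ∈ Set.Ioc (0:ℝ) εstar, ∀ N : ℕ, Even N → 4 ≤ N →
      ∀ i : ℕ, 1 ≤ i → i ≤ N - 1 →
        |(bphi a ε p (((i:ℝ) + 1) / N) - bphi a ε p ((i:ℝ) / N))
          - (bphi a ε p ((i:ℝ) / N) - bphi a ε p (((i:ℝ) - 1) / N))| ≤ C / (N:ℝ)^2 := by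
  obtain ⟨hp1, hp2⟩ := hp
  have hp0 : 0 < p := (Real.rpow_pos_of_pos hεstar.1 _).trans hp1
  have hr : 0 < 1 / 2 - p := by linarith
  refine ⟨2 * (2 * a * p + 3 * (1 / 2 - p)⁻¹ ^ 3), by positivity, ?_⟩
  intro ε hε N _ _ i _ _
  have hεp : ε ^ ((1:ℝ)/3) < p :=
    (Real.rpow_le_rpow hε.1.le hε.2 (by norm_num)).trans_lt hp1
  obtain ⟨f', hf, hL⟩ := bphi_exists_lipschitz_deriv hε.1 hεp hp2 ha (hω ε hε)
  have := abs_second_difference_le (x := (i:ℝ) / N) (h := 1 / N) (by positivity)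
    (by positivity) hf hL
  rw [← add_div, ← sub_div] at this
  exact this.trans_eq (by ring)
end

section
/- There exists an absolute constant C > 0 such that for every β > 0 and all real numbers 0 < h₁ ≤ h₂: |h₂·sinh(βh₁) − h₁·sinh(βh₂)| / D(β,h₁,h₂) ≤ C·(h₂ − h₁). -/
/-- Mean value bounds for `sinh` on the nonnegative half-line. -/
theorem Real.sinh_sub_sinh_mem_Icc {x y : ℝ} (hx : 0 ≤ x) (hxy : x ≤ y) :
    Real.sinh y - Real.sinh x ∈
      Set.Icc ((y - x) * Real.cosh x) ((y - x) * Real.cosh y) := by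
  rcases hxy.eq_or_lt with rfl | hlt
  · simp
  obtain ⟨c, ⟨hxc, hcy⟩, hc⟩ := exists_hasDerivAt_eq_slope Real.sinh Real.cosh hlt
    Real.continuous_sinh.continuousOn fun z _ => Real.hasDerivAt_sinh z
  have hpos : 0 < y - x := sub_pos.2 hlt
  rw [eq_div_iff hpos.ne', mul_comm] at hc
  rw [← hc]
  have h₁ : Real.cosh x ≤ Real.cosh c := by
    rw [Real.cosh_le_cosh, abs_of_nonneg hx, abs_of_nonneg (hx.trans hxc.le)]
    exact hxc.le
  have h₂ : Real.cosh c ≤ Real.cosh y := by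
    rw [Real.cosh_le_cosh, abs_of_nonneg (hx.trans hxc.le), abs_of_nonneg (hx.trans hxy)]
    exact hcy.le
  exact ⟨mul_le_mul_of_nonneg_left h₁ hpos.le, mul_le_mul_of_nonneg_left h₂ hpos.le⟩

/-- The unscaled bound: the case `β = 1`, with constant `1`. -/
theorem abs_mul_sinh_sub_mul_sinh_le {x y : ℝ} (hx : 0 < x) (hxy : x ≤ y) :
    |y * Real.sinh x - x * Real.sinh y| ≤
      (y - x) * (Real.sinh y * (Real.cosh x - 1) + Real.sinh x * (Real.cosh y - 1)) := by
  obtain ⟨hl, hu⟩ := Real.sinh_sub_sinh_mem_Icc hx.le hxy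
  have hs : Real.sinh x ≤ x * Real.cosh x := by
    simpa using (Real.sinh_sub_sinh_mem_Icc le_rfl hx.le).2
  have hself : x ≤ Real.sinh x := Real.self_le_sinh_iff.2 hx.le
  have hd : 0 ≤ y - x := sub_nonneg.2 hxy
  have hsy : 0 ≤ Real.sinh y * (Real.cosh x - 1) :=
    mul_nonneg (Real.sinh_nonneg_iff.2 (hx.le.trans hxy)) (sub_nonneg.2 (Real.one_le_cosh x))
  have hsign : y * Real.sinh x - x * Real.sinh y ≤ 0 := by
    linarith [mul_le_mul_of_nonneg_left hl hx.le, mul_le_mul_of_nonneg_left hs hd]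
  rw [abs_of_nonpos hsign]
  have hcosh : x * Real.cosh y ≤ Real.sinh x * Real.cosh y :=
    mul_le_mul_of_nonneg_right hself (Real.cosh_pos y).le
  linarith [mul_le_mul_of_nonneg_left hu hx.le, mul_le_mul_of_nonneg_left hcosh hd,
    mul_nonneg hd hsy]


/-- There is an absolute constant `C > 0` such that for all `β > 0` and `0 < h₁ ≤ h₂`,
`|h₂ sinh(βh₁) - h₁ sinh(βh₂)| / D ≤ C (h₂ - h₁)`, where
`D = sinh(βh₂)(cosh(βh₁) - 1) + sinh(βh₁)(cosh(βh₂) - 1)`. -/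
theorem sinh_weighted_difference_bound :
    ∃ C > 0, ∀ β : ℝ, 0 < β → ∀ h₁ h₂ : ℝ, 0 < h₁ → h₁ ≤ h₂ →
      |h₂ * Real.sinh (β * h₁) - h₁ * Real.sinh (β * h₂)| /
        (Real.sinh (β * h₂) * (Real.cosh (β * h₁) - 1)
          + Real.sinh (β * h₁) * (Real.cosh (β * h₂) - 1)) ≤ C * (h₂ - h₁) := by
  refine ⟨1, one_pos, fun β hβ h₁ h₂ hh₁ hh => ?_⟩
  have hx : 0 < β * h₁ := mul_pos hβ hh₁
  have hy : 0 < β * h₂ := mul_pos hβ (hh₁.trans_le hh)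
  have key := abs_mul_sinh_sub_mul_sinh_le hx (mul_le_mul_of_nonneg_left hh hβ.le)
  have hD : 0 < Real.sinh (β * h₂) * (Real.cosh (β * h₁) - 1)
      + Real.sinh (β * h₁) * (Real.cosh (β * h₂) - 1) :=
    add_pos
      (mul_pos (Real.sinh_pos_iff.2 hy) (sub_pos.2 (Real.one_lt_cosh.2 hx.ne')))
      (mul_pos (Real.sinh_pos_iff.2 hx) (sub_pos.2 (Real.one_lt_cosh.2 hy.ne')))
  rw [div_le_iff₀ hD, one_mul]
  rw [mul_assoc β, mul_assoc β, ← mul_sub, abs_mul, abs_of_pos hβ, ← mul_sub, mul_assoc β] at key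
  exact le_of_mul_le_mul_left key hβ
end

section
/- There exists an absolute constant C > 0 such that for every β > 0 and all real numbers 0 < h₁ ≤ h₂: | (1/2)·(h₁²·sinh(βh₂) + h₂²·sinh(βh₁)) − β^{−2}·D(β,h₁,h₂) | / D(β,h₁,h₂) ≤ C·h₂². -/
/-- A quadratic lower bound for `cosh`. -/
lemma half_sq_le_cosh_sub_one (t : ℝ) : t ^ 2 / 2 ≤ Real.cosh t - 1 := by
  have h1 : Real.cosh t = 2 * Real.sinh (t / 2) ^ 2 + 1 := by
    have h := Real.cosh_two_mul (t / 2)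
    rw [mul_div_cancel₀ t two_ne_zero, Real.cosh_sq] at h
    linarith
  have h2 : (t / 2) ^ 2 ≤ Real.sinh (t / 2) ^ 2 := by
    rw [sq_le_sq, Real.abs_sinh]
    exact Real.self_le_sinh_iff.2 (abs_nonneg _)
  linarith

/-- The second-order Taylor remainder of `cosh` at `0` is controlled by `t² (cosh t - 1)`. -/
lemma cosh_sub_one_sub_half_sq_le (t : ℝ) :
    Real.cosh t - 1 - t ^ 2 / 2 ≤ t ^ 2 * (Real.cosh t - 1) := by
  have hc := Real.one_le_cosh t
  have key : Real.cosh t * (1 - t ^ 2 / 2) ≤ 1 := by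
    rcases le_total (1 - t ^ 2 / 2) 0 with h | h
    · nlinarith
    · calc Real.cosh t * (1 - t ^ 2 / 2)
          ≤ Real.exp (t ^ 2 / 2) * Real.exp (-(t ^ 2 / 2)) :=
            mul_le_mul (Real.cosh_le_exp_half_sq t) (Real.one_sub_le_exp_neg _) h
              (Real.exp_pos _).le
        _ = 1 := by rw [← Real.exp_add, add_neg_cancel, Real.exp_zero]
  nlinarith [mul_nonneg (sq_nonneg t) (sub_nonneg.2 hc)]


/-- There is an absolute constant `C > 0` such that for all `β > 0` and `0 < h₁ ≤ h₂`,
`|(1/2)(h₁² sinh(βh₂) + h₂² sinh(βh₁)) - β⁻² D| / D ≤ C h₂²`, where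
`D = sinh(βh₂)(cosh(βh₁) - 1) + sinh(βh₁)(cosh(βh₂) - 1)`. -/
theorem sinh_second_order_bound :
    ∃ C > 0, ∀ β : ℝ, 0 < β → ∀ h₁ h₂ : ℝ, 0 < h₁ → h₁ ≤ h₂ →
      |(1 / 2) * (h₁ ^ 2 * Real.sinh (β * h₂) + h₂ ^ 2 * Real.sinh (β * h₁))
          - β⁻¹ ^ 2 *
            (Real.sinh (β * h₂) * (Real.cosh (β * h₁) - 1)
              + Real.sinh (β * h₁) * (Real.cosh (β * h₂) - 1))| /
        (Real.sinh (β * h₂) * (Real.cosh (β * h₁) - 1)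
          + Real.sinh (β * h₁) * (Real.cosh (β * h₂) - 1)) ≤ C * h₂ ^ 2 := by
  refine ⟨1, one_pos, fun β hβ h₁ h₂ hh₁ hh => ?_⟩
  have hx : 0 < β * h₁ := mul_pos hβ hh₁
  have hy : 0 < β * h₂ := mul_pos hβ (hh₁.trans_le hh)
  have hxy : (β * h₁) ^ 2 ≤ (β * h₂) ^ 2 := by gcongr
  have e₁ : h₁ = β⁻¹ * (β * h₁) := by field_simp
  have e₂ : h₂ = β⁻¹ * (β * h₂) := by field_simp
  generalize β * h₁ = x at *
  generalize β * h₂ = y at *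
  subst e₁ e₂
  have hsx := Real.sinh_pos_iff.2 hx
  have hsy := Real.sinh_pos_iff.2 hy
  have hcx : 0 < Real.cosh x - 1 := by linarith [Real.one_lt_cosh.2 hx.ne']
  have hcy : 0 < Real.cosh y - 1 := by linarith [Real.one_lt_cosh.2 hy.ne']
  have lx := mul_le_mul_of_nonneg_left (half_sq_le_cosh_sub_one x) hsy.le
  have ly := mul_le_mul_of_nonneg_left (half_sq_le_cosh_sub_one y) hsx.le
  have ux := mul_le_mul_of_nonneg_left ((cosh_sub_one_sub_half_sq_le x).trans
    (mul_le_mul_of_nonneg_right hxy hcx.le)) hsy.le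
  have uy := mul_le_mul_of_nonneg_left (cosh_sub_one_sub_half_sq_le y) hsx.le
  rw [div_le_iff₀ (by positivity), abs_le]
  have hb := sq_nonneg β⁻¹
  have hlow := mul_le_mul_of_nonneg_left (add_le_add lx ly) hb
  have hupp := mul_le_mul_of_nonneg_left (add_le_add ux uy) hb
  have hpos : 0 ≤ 1 * (β⁻¹ * y) ^ 2 *
      (Real.sinh y * (Real.cosh x - 1) + Real.sinh x * (Real.cosh y - 1)) := by positivity
  constructor <;> linarith
end

section
/- Let γ > 0 and 0 < ε < 1 and set β = √γ/ε. There exists a constant C > 0 depending only on γ such that for all real numbers 0 < h₁ ≤ h₂: |h₂³·sinh(βh₁) − h₁³·sinh(βh₂)| / D(β,h₁,h₂) ≤ C·(ε² + h₁²)·(h₂ − h₁). -/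
theorem one_add_sq_div_two_le_cosh (x : ℝ) : 1 + x ^ 2 / 2 ≤ Real.cosh x := by
  have h : Real.cosh x = 1 + 2 * Real.sinh (x / 2) ^ 2 := by
    have h2 := Real.cosh_two_mul (x / 2)
    rw [mul_div_cancel₀ x two_ne_zero, Real.cosh_sq] at h2
    linarith
  have h3 : |x / 2| ≤ Real.sinh |x / 2| := Real.self_le_sinh_iff.2 (abs_nonneg _)
  have h4 : |x / 2| ^ 2 ≤ Real.sinh |x / 2| ^ 2 := by gcongr
  rw [← Real.abs_sinh, sq_abs, sq_abs] at h4
  linarith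

theorem sinh_sub_sinh_le {x y : ℝ} (hx : 0 ≤ x) (hxy : x ≤ y) :
    Real.sinh y - Real.sinh x ≤ (y - x) * (1 + Real.sinh y) := by
  have e1 : Real.exp x = Real.exp y * Real.exp (x - y) := by rw [← Real.exp_add]; ring_nf
  have e2 : Real.exp (-y) = Real.exp (-x) * Real.exp (x - y) := by rw [← Real.exp_add]; ring_nf
  have h := Real.add_one_le_exp (x - y)
  have hx1 : Real.exp (-x) ≤ 1 := Real.exp_le_one_iff.2 (by linarith)
  have hy1 : Real.exp (-y) ≤ 1 := Real.exp_le_one_iff.2 (by linarith)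
  have a1 : Real.exp y - Real.exp x ≤ (y - x) * Real.exp y := by
    nlinarith [mul_le_mul_of_nonneg_left h (Real.exp_pos y).le]
  have a2 : Real.exp (-x) - Real.exp (-y) ≤ (y - x) * Real.exp (-x) := by
    nlinarith [mul_le_mul_of_nonneg_left h (Real.exp_pos (-x)).le]
  have a3 := mul_le_mul_of_nonneg_left hx1 (sub_nonneg.2 hxy)
  have a4 := mul_le_mul_of_nonneg_left hy1 (sub_nonneg.2 hxy)
  rw [Real.sinh_eq, Real.sinh_eq]
  linarith

theorem abs_cube_mul_sinh_sub_le {x y : ℝ} (hx : 0 < x) (hxy : x ≤ y) :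
    |y ^ 3 * Real.sinh x - x ^ 3 * Real.sinh y| ≤
      (9 + x ^ 2) * (y - x) *
        (Real.sinh y * (Real.cosh x - 1) + Real.sinh x * (Real.cosh y - 1)) := by
  have hsx : x ≤ Real.sinh x := Real.self_le_sinh_iff.2 hx.le
  have hsxy : Real.sinh x ≤ Real.sinh y := Real.sinh_le_sinh.2 hxy
  have hcx := one_add_sq_div_two_le_cosh x
  have hcy := one_add_sq_div_two_le_cosh y
  have hd : 0 ≤ y - x := sub_nonneg.2 hxy
  have hsx0 : 0 < Real.sinh x := hx.trans_le hsx
  have hsy0 : 0 < Real.sinh y := hsx0.trans_le hsxy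
  have hs := sinh_sub_sinh_le hx.le hxy
  generalize Real.sinh x = a at *
  generalize Real.sinh y = b at *
  generalize Real.cosh x = c at *
  generalize Real.cosh y = d at *
  set D := b * (c - 1) + a * (d - 1) with hD
  have hbD : b * (x ^ 2 / 2) ≤ b * (c - 1) := by gcongr; linarith
  have haD : a * (y ^ 2 / 2) ≤ a * (d - 1) := by gcongr; linarith
  have hb0 : 0 ≤ b * (x ^ 2 / 2) := by positivity
  have ha0 : 0 ≤ a * (y ^ 2 / 2) := by positivity
  have hD0 : 0 ≤ D := by linarith
  have t1 : (y ^ 2 + x * y + x ^ 2) * a ≤ 6 * D := by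
    have : y ^ 2 + x * y + x ^ 2 ≤ 3 * y ^ 2 := by nlinarith
    have := mul_le_mul_of_nonneg_right this hsx0.le
    linarith
  have t2 : x ^ 3 * (1 + b) ≤ (3 + x ^ 2) * D := by
    have h1 : x ^ 3 ≤ 2 * D := by
      have : x * x ^ 2 ≤ b * x ^ 2 := by gcongr; linarith
      linarith
    have h2 : x * (b * x ^ 2) ≤ x * (2 * D) :=
      mul_le_mul_of_nonneg_left (by linarith) hx.le
    nlinarith [mul_nonneg (sq_nonneg (x - 1)) hD0]
  have u1 := mul_le_mul_of_nonneg_left t1 hd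
  have u2 := mul_le_mul_of_nonneg_left t2 hd
  have u3 := mul_le_mul_of_nonneg_left hs (pow_pos hx 3).le
  have p1 : 0 ≤ (y - x) * ((y ^ 2 + x * y + x ^ 2) * a) := by
    have : 0 < y := hx.trans_le hxy
    positivity
  have p2 : 0 ≤ x ^ 3 * (b - a) := mul_nonneg (by positivity) (by linarith)
  rw [abs_le]
  constructor <;> linarith


/-- With `β = √γ/ε`, there is a constant `C > 0` depending only on `γ` such that for all
`0 < h₁ ≤ h₂`, `|h₂³ sinh(βh₁) - h₁³ sinh(βh₂)| / D ≤ C (ε² + h₁²)(h₂ - h₁)`, where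
`D = sinh(βh₂)(cosh(βh₁) - 1) + sinh(βh₁)(cosh(βh₂) - 1)`. -/
theorem sinh_third_order_bound (γ : ℝ) (hγ : 0 < γ) :
    ∃ C > 0, ∀ ε : ℝ, 0 < ε → ε < 1 → ∀ h₁ h₂ : ℝ, 0 < h₁ → h₁ ≤ h₂ →
      |h₂ ^ 3 * Real.sinh (Real.sqrt γ / ε * h₁)
          - h₁ ^ 3 * Real.sinh (Real.sqrt γ / ε * h₂)| /
        (Real.sinh (Real.sqrt γ / ε * h₂) * (Real.cosh (Real.sqrt γ / ε * h₁) - 1)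
          + Real.sinh (Real.sqrt γ / ε * h₁) * (Real.cosh (Real.sqrt γ / ε * h₂) - 1)) ≤
        C * (ε ^ 2 + h₁ ^ 2) * (h₂ - h₁) := by
  refine ⟨9 / γ + 1, by positivity, fun ε hε _ h₁ h₂ hh₁ hh => ?_⟩
  set β := Real.sqrt γ / ε with hβ
  have hβ0 : 0 < β := div_pos (Real.sqrt_pos.2 hγ) hε
  have hβε : β ^ 2 * ε ^ 2 = γ := by
    rw [hβ, div_pow, Real.sq_sqrt hγ.le]
    field_simp
  have hx : 0 < β * h₁ := by positivity
  have hxy : β * h₁ ≤ β * h₂ := by gcongr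
  have key := abs_cube_mul_sinh_sub_le hx hxy
  have hs1 : 0 < Real.sinh (β * h₁) := Real.sinh_pos_iff.2 hx
  have hs2 : 0 < Real.sinh (β * h₂) := Real.sinh_pos_iff.2 (hx.trans_le hxy)
  have hc1 : 1 < Real.cosh (β * h₁) := Real.one_lt_cosh.2 hx.ne'
  have hc2 : 1 < Real.cosh (β * h₂) := Real.one_lt_cosh.2 (hx.trans_le hxy).ne'
  have hD : 0 < Real.sinh (β * h₂) * (Real.cosh (β * h₁) - 1)
      + Real.sinh (β * h₁) * (Real.cosh (β * h₂) - 1) :=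
    add_pos (mul_pos hs2 (sub_pos.2 hc1)) (mul_pos hs1 (sub_pos.2 hc2))
  rw [div_le_iff₀ hD]
  generalize Real.sinh (β * h₂) * (Real.cosh (β * h₁) - 1)
      + Real.sinh (β * h₁) * (Real.cosh (β * h₂) - 1) = D at *
  have hfac : 9 + (β * h₁) ^ 2 ≤ (9 / γ + 1) * (γ + (β * h₁) ^ 2) := by
    have e : (9 / γ + 1) * (γ + (β * h₁) ^ 2)
        = 9 + (β * h₁) ^ 2 + (γ + 9 / γ * (β * h₁) ^ 2) := by
      field_simp
      ring
    rw [e]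
    have : 0 ≤ γ + 9 / γ * (β * h₁) ^ 2 := by positivity
    linarith
  have hscale : (β * h₂) ^ 3 * Real.sinh (β * h₁) - (β * h₁) ^ 3 * Real.sinh (β * h₂)
      = β ^ 3 * (h₂ ^ 3 * Real.sinh (β * h₁) - h₁ ^ 3 * Real.sinh (β * h₂)) := by ring
  rw [hscale, abs_mul, abs_of_pos (pow_pos hβ0 3)] at key
  refine le_of_mul_le_mul_left (key.trans ?_) (pow_pos hβ0 3)
  have hmul := mul_le_mul_of_nonneg_right
    (mul_le_mul_of_nonneg_right hfac (sub_nonneg.2 hxy)) hD.le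
  refine hmul.trans_eq ?_
  rw [← hβε]
  ring
end

section
/- Let γ > 0 and 0 < ε < 1 and set β = √γ/ε. There exists a constant C > 0 depending only on γ such that for all real numbers 0 < h₁ ≤ h₂ and all A, B ≥ 0: (A·h₁⁴·sinh(βh₂) + B·h₂⁴·sinh(βh₁)) / D(β,h₁,h₂) ≤ C·ε²·(A·h₁² + B·h₂²). -/
theorem Real.sq_div_two_le_cosh_sub_one {x : ℝ} (hx : 0 ≤ x) :
    x ^ 2 / 2 ≤ Real.cosh x - 1 := by
  have h1 : x / 2 ≤ Real.sinh (x / 2) := Real.self_le_sinh_iff.2 (by positivity)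
  have h2 : Real.cosh x = 2 * Real.sinh (x / 2) ^ 2 + 1 := by
    have h := Real.cosh_two_mul (x / 2)
    rw [mul_div_cancel₀ x two_ne_zero, Real.cosh_sq] at h
    linarith
  nlinarith

/-- With `β = √γ/ε`, there is a constant `C > 0` depending only on `γ` such that for all
`0 < h₁ ≤ h₂` and `A, B ≥ 0`,
`(A h₁⁴ sinh(βh₂) + B h₂⁴ sinh(βh₁)) / D ≤ C ε² (A h₁² + B h₂²)`, where
`D = sinh(βh₂)(cosh(βh₁) - 1) + sinh(βh₁)(cosh(βh₂) - 1)`. -/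
theorem sinh_fourth_order_bound (γ : ℝ) (hγ : 0 < γ) :
    ∃ C > 0, ∀ ε : ℝ, 0 < ε → ε < 1 → ∀ h₁ h₂ : ℝ, 0 < h₁ → h₁ ≤ h₂ →
      ∀ A B : ℝ, 0 ≤ A → 0 ≤ B →
      (A * h₁ ^ 4 * Real.sinh (Real.sqrt γ / ε * h₂)
          + B * h₂ ^ 4 * Real.sinh (Real.sqrt γ / ε * h₁)) /
        (Real.sinh (Real.sqrt γ / ε * h₂) * (Real.cosh (Real.sqrt γ / ε * h₁) - 1)
          + Real.sinh (Real.sqrt γ / ε * h₁) * (Real.cosh (Real.sqrt γ / ε * h₂) - 1)) ≤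
        C * ε ^ 2 * (A * h₁ ^ 2 + B * h₂ ^ 2) := by
  refine ⟨2 / γ, by positivity, fun ε hε _ h₁ h₂ hh₁ hle A B hA hB => ?_⟩
  have hh₂ : 0 < h₂ := hh₁.trans_le hle
  have hβ : 0 < Real.sqrt γ / ε := div_pos (Real.sqrt_pos.2 hγ) hε
  have hC : 2 / γ * ε ^ 2 = 2 / (Real.sqrt γ / ε) ^ 2 := by
    rw [div_pow, Real.sq_sqrt hγ.le]
    field_simp
  rw [hC]
  generalize Real.sqrt γ / ε = β at hβ ⊢
  have hs₁ : 0 < Real.sinh (β * h₁) := Real.sinh_pos_iff.2 (by positivity)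
  have hs₂ : 0 < Real.sinh (β * h₂) := Real.sinh_pos_iff.2 (by positivity)
  have hc₁ := Real.sq_div_two_le_cosh_sub_one (x := β * h₁) (by positivity)
  have hc₂ := Real.sq_div_two_le_cosh_sub_one (x := β * h₂) (by positivity)
  have hp₁ : 0 < Real.cosh (β * h₁) - 1 := lt_of_lt_of_le (by positivity) hc₁
  have hp₂ : 0 < Real.cosh (β * h₂) - 1 := lt_of_lt_of_le (by positivity) hc₂
  rw [div_le_iff₀ (by positivity)]
  generalize Real.cosh (β * h₁) - 1 = c₁ at *
  generalize Real.cosh (β * h₂) - 1 = c₂ at *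
  generalize Real.sinh (β * h₁) = s₁ at *
  generalize Real.sinh (β * h₂) = s₂ at *
  have hD₁ : h₁ ^ 2 * s₂ ≤ 2 / β ^ 2 * (s₂ * c₁ + s₁ * c₂) :=
    calc h₁ ^ 2 * s₂ = 2 / β ^ 2 * (s₂ * ((β * h₁) ^ 2 / 2)) := by field_simp
      _ ≤ 2 / β ^ 2 * (s₂ * c₁) := by gcongr
      _ ≤ _ := by gcongr; exact le_add_of_nonneg_right (by positivity)
  have hD₂ : h₂ ^ 2 * s₁ ≤ 2 / β ^ 2 * (s₂ * c₁ + s₁ * c₂) :=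
    calc h₂ ^ 2 * s₁ = 2 / β ^ 2 * (s₁ * ((β * h₂) ^ 2 / 2)) := by field_simp
      _ ≤ 2 / β ^ 2 * (s₁ * c₂) := by gcongr
      _ ≤ _ := by gcongr; exact le_add_of_nonneg_left (by positivity)
  calc A * h₁ ^ 4 * s₂ + B * h₂ ^ 4 * s₁
      = A * h₁ ^ 2 * (h₁ ^ 2 * s₂) + B * h₂ ^ 2 * (h₂ ^ 2 * s₁) := by ring
    _ ≤ A * h₁ ^ 2 * (2 / β ^ 2 * (s₂ * c₁ + s₁ * c₂))
        + B * h₂ ^ 2 * (2 / β ^ 2 * (s₂ * c₁ + s₁ * c₂)) := by gcongr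
    _ = _ := by ring
end

section
/- Let κ(t) = aεt/(p − t) with a > 0, 0 < ε < 1, 0 < p < 1/2, and let h = 1/N with N ≥ 4. If t ≥ 0 satisfies t + 2h ≤ p − ε^{1/3} and t ≤ p − 3h, then: (i) κ(t + 2h) − κ(t + h) ≤ 9aεp/( N·(p − t)² ), and (ii) [κ(t + 2h) − κ(t + h)] − [κ(t + h) − κ(t)] ≤ 54aεp/( N²·(p − t)³ ). -/
/-- The increment of `κ` over two points different from the pole `p`. -/
theorem bkappa_sub (a ε : ℝ) {p u v : ℝ} (hu : p - u ≠ 0) (hv : p - v ≠ 0) :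
    bkappa a ε p v - bkappa a ε p u = a * ε * p * (v - u) / ((p - u) * (p - v)) := by
  unfold bkappa
  field_simp
  ring

/-- The second difference of `κ` with step `h`, away from the pole `p`. -/
theorem bkappa_second_difference (a ε : ℝ) {p t h : ℝ} (h₀ : p - t ≠ 0)
    (h₁ : p - (t + h) ≠ 0) (h₂ : p - (t + 2 * h) ≠ 0) :
    (bkappa a ε p (t + 2 * h) - bkappa a ε p (t + h)) - (bkappa a ε p (t + h) - bkappa a ε p t) =
      2 * a * ε * p * h ^ 2 / ((p - t) * (p - (t + h)) * (p - (t + 2 * h))) := by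
  rw [bkappa_sub a ε h₁ h₂, bkappa_sub a ε h₀ h₁]
  field_simp
  ring

/-- Step bounds inside the layer region of the Bakhvalov-type mesh: with `h = 1/N`, if
`t + 2h ≤ p - ε^{1/3}` and `t ≤ p - 3h`, then
`κ(t+2h) - κ(t+h) ≤ 9aεp/(N(p-t)²)` and
`[κ(t+2h) - κ(t+h)] - [κ(t+h) - κ(t)] ≤ 54aεp/(N²(p-t)³)`. -/
theorem kappa_step_bounds
    (a ε p : ℝ) (ha : 0 < a) (hε0 : 0 < ε) (hε1 : ε < 1)
    (hp0 : 0 < p) (hp2 : p < 1 / 2)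
    (N : ℕ) (hN : 4 ≤ N) (t : ℝ) (ht : 0 ≤ t)
    (h1 : t + 2 * (1 / (N:ℝ)) ≤ p - ε ^ ((1:ℝ)/3))
    (h2 : t ≤ p - 3 * (1 / (N:ℝ))) :
    bkappa a ε p (t + 2 * (1 / (N:ℝ))) - bkappa a ε p (t + 1 / (N:ℝ)) ≤
        9 * a * ε * p / ((N:ℝ) * (p - t) ^ 2) ∧
      (bkappa a ε p (t + 2 * (1 / (N:ℝ))) - bkappa a ε p (t + 1 / (N:ℝ)))
          - (bkappa a ε p (t + 1 / (N:ℝ)) - bkappa a ε p t) ≤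
        54 * a * ε * p / ((N:ℝ) ^ 2 * (p - t) ^ 3) := by
  have hN0 : (0 : ℝ) < N := by exact_mod_cast (by omega : 0 < N)
  have e₁ : 9 * a * ε * p / ((N:ℝ) * (p - t) ^ 2) =
      9 * (a * ε * p) * (1 / (N:ℝ)) / (p - t) ^ 2 := by
    field_simp
  have e₂ : 54 * a * ε * p / ((N:ℝ) ^ 2 * (p - t) ^ 3) =
      54 * (a * ε * p) * (1 / (N:ℝ)) ^ 2 / (p - t) ^ 3 := by
    field_simp
  rw [e₁, e₂]
  have hh : 0 < 1 / (N:ℝ) := by positivity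
  generalize 1 / (N:ℝ) = h at *
  have hc : 0 < a * ε * p := by positivity
  have hs : 0 < p - t := by linarith
  have hs₁ : 0 < p - (t + h) := by linarith
  have hs₂ : 0 < p - (t + 2 * h) := by linarith
  have hprod : 2 * (p - t) ^ 2 ≤ 9 * ((p - (t + h)) * (p - (t + 2 * h))) := by
    nlinarith
  constructor
  · rw [bkappa_sub a ε hs₁.ne' hs₂.ne', div_le_div_iff₀ (by positivity) (by positivity)]
    have hch : 0 < a * ε * p * h := by positivity
    nlinarith [mul_le_mul_of_nonneg_left hprod hch.le, mul_pos hch (mul_pos hs₁ hs₂)]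
  · rw [bkappa_second_difference a ε hs.ne' hs₁.ne' hs₂.ne',
      div_le_div_iff₀ (by positivity) (by positivity)]
    have hch : 0 < a * ε * p * h ^ 2 * (p - t) := by positivity
    nlinarith [mul_le_mul_of_nonneg_left hprod hch.le, mul_pos hch (mul_pos hs₁ hs₂)]
end

section
/- Let κ(t) = aεt/(p − t) with a > 0, 0 < ε < 1, 0 < p < 1/2, and let h = 1/N with N ≥ 4. If t ≥ 0 satisfies t + h ≤ p − ε^{1/3} and t > p − 3h, then κ(t + h) − κ(t) ≥ aεp/(9h). -/
/-- Step lower bound near the transition point of the Bakhvalov-type mesh: with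
`h = 1/N`, if `t + h ≤ p - ε^{1/3}` and `t > p - 3h`, then
`κ(t+h) - κ(t) ≥ aεp/(9h)`. -/
theorem kappa_step_lower_bound
    (a ε p : ℝ) (ha : 0 < a) (hε0 : 0 < ε) (hε1 : ε < 1)
    (hp0 : 0 < p) (hp2 : p < 1 / 2)
    (N : ℕ) (hN : 4 ≤ N) (t : ℝ) (ht : 0 ≤ t)
    (h1 : t + 1 / (N:ℝ) ≤ p - ε ^ ((1:ℝ)/3))
    (h2 : p - 3 * (1 / (N:ℝ)) < t) :
    a * ε * p / (9 * (1 / (N:ℝ))) ≤ bkappa a ε p (t + 1 / (N:ℝ)) - bkappa a ε p t := by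
  have hh : (0:ℝ) < 1 / (N:ℝ) := by
    have : (0:ℝ) < N := by exact_mod_cast (by omega : 0 < N)
    positivity
  have hr : 0 < ε ^ ((1:ℝ)/3) := Real.rpow_pos_of_pos hε0 _
  generalize 1 / (N:ℝ) = h at *
  have hv : 0 < p - (t + h) := by linarith
  have hu : 0 < p - t := by linarith
  have hstep : bkappa a ε p (t + h) - bkappa a ε p t
      = a * ε * p * h / ((p - (t + h)) * (p - t)) := by
    unfold bkappa
    rw [div_sub_div _ _ hv.ne' hu.ne']
    congr 1
    ring
  have hden : (p - (t + h)) * (p - t) ≤ h * (9 * h) := by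
    nlinarith [mul_le_mul (by linarith : p - (t + h) ≤ 3 * h) (by linarith : p - t ≤ 3 * h)
      hu.le (by linarith)]
  rw [hstep, div_le_div_iff₀ (by positivity) (by positivity), mul_assoc (a * ε * p)]
  exact mul_le_mul_of_nonneg_left hden (by positivity)
end

section
/- In the setting of the Bakhvalov-type mesh generating function, if ap/ε^{1/3} > ω, then κ'''(t) − π'''(t) > 0 for all t ∈ [α, p), and consequently κ^{(k)}(t) > π^{(k)}(t) for k = 0, 1, 2 and all t ∈ (α, p). -/
theorem hasDerivAt_bkappa (a ε : ℝ) {p t : ℝ} (ht : p - t ≠ 0) :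
    HasDerivAt (bkappa a ε p) (a * ε * p / (p - t) ^ 2) t := by
  have h := ((hasDerivAt_id t).const_mul (a * ε)).div ((hasDerivAt_id t).const_sub p) ht
  refine h.congr_deriv ?_
  simp only [id]
  ring

theorem hasDerivAt_deriv_bkappa (a ε : ℝ) {p t : ℝ} (ht : p - t ≠ 0) :
    HasDerivAt (deriv (bkappa a ε p)) (2 * (a * ε * p) / (p - t) ^ 3) t := by
  have hev : deriv (bkappa a ε p) =ᶠ[nhds t] fun x => a * ε * p / (p - x) ^ 2 := by
    have hc : ContinuousAt (fun x : ℝ => p - x) t := by fun_prop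
    filter_upwards [hc.eventually_ne ht] with x hx
    exact (hasDerivAt_bkappa a ε hx).deriv
  refine HasDerivAt.congr_of_eventuallyEq ?_ hev
  have h := (hasDerivAt_const t (a * ε * p)).div
    (((hasDerivAt_id t).const_sub p).pow 2) (pow_ne_zero 2 ht)
  refine h.congr_deriv ?_
  simp only [id, Pi.pow_apply]
  field_simp
  ring

theorem hasDerivAt_cubic (w b d e α t : ℝ) :
    HasDerivAt (fun x : ℝ => w * (x - α) ^ 3 + b * (x - α) ^ 2 / 2 + d * (x - α) + e)
      (3 * w * (t - α) ^ 2 + b * (t - α) + d) t := by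
  have h := (hasDerivAt_id t).sub_const α
  refine (((((h.pow 3).const_mul w).add (((h.pow 2).const_mul b).div_const 2)).add
    (h.const_mul d)).add_const e).congr_deriv ?_
  simp only [id]
  norm_num
  ring

theorem hasDerivAt_quadratic (w b d α t : ℝ) :
    HasDerivAt (fun x : ℝ => 3 * w * (x - α) ^ 2 + b * (x - α) + d)
      (6 * w * (t - α) + b) t := by
  have h := (hasDerivAt_id t).sub_const α
  refine ((((h.pow 2).const_mul (3 * w)).add (h.const_mul b)).add_const d).congr_deriv ?_
  simp only [id]
  norm_num
  ring

theorem deriv_bpi (a ε p : ℝ) :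
    deriv (bpi a ε p) = fun t => 3 * bomega a ε p * (t - (p - ε ^ ((1:ℝ)/3))) ^ 2
      + (2 * a * ε * p / (p - (p - ε ^ ((1:ℝ)/3))) ^ 3) * (t - (p - ε ^ ((1:ℝ)/3)))
      + a * ε * p / (p - (p - ε ^ ((1:ℝ)/3))) ^ 2 :=
  funext fun _ => (hasDerivAt_cubic _ _ _ _ _ _).deriv

theorem deriv_deriv_bpi (a ε p t : ℝ) :
    deriv (deriv (bpi a ε p)) t = 6 * bomega a ε p * (t - (p - ε ^ ((1:ℝ)/3)))
      + 2 * a * ε * p / (p - (p - ε ^ ((1:ℝ)/3))) ^ 3 := by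
  rw [deriv_bpi]
  exact (hasDerivAt_quadratic _ _ _ _ _).deriv

/-- If `ap/ε^{1/3} > ω`, then `κ''' - π''' > 0` on `[α, p)` (with
`κ'''(t) = 6aεp/(p-t)⁴` and `π''' = 6ω`), and consequently `κ^{(k)} > π^{(k)}` for
`k = 0, 1, 2` on `(α, p)`. -/
theorem kappa_pi_comparison
    (εstar p a ε : ℝ)
    (hεstar : εstar ∈ Set.Ioo (0:ℝ) (1/8))
    (hp : p ∈ Set.Ioo (εstar ^ ((1:ℝ)/3)) (1/2))
    (ha : 0 < a) (hε : ε ∈ Set.Ioc (0:ℝ) εstar)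
    (hω : 0 ≤ bomega a ε p)
    (hcond : a * p / ε ^ ((1:ℝ)/3) > bomega a ε p) :
    (∀ t ∈ Set.Ico (p - ε ^ ((1:ℝ)/3)) p,
        0 < 6 * a * ε * p / (p - t) ^ 4 - 6 * bomega a ε p) ∧
    (∀ t ∈ Set.Ioo (p - ε ^ ((1:ℝ)/3)) p,
        bpi a ε p t < bkappa a ε p t ∧
        deriv (bpi a ε p) t < deriv (bkappa a ε p) t ∧
        deriv (deriv (bpi a ε p)) t < deriv (deriv (bkappa a ε p)) t) := by
  have hε0 : 0 < ε := hε.1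
  have hp0 : 0 < p := (Real.rpow_pos_of_pos hεstar.1 _).trans hp.1
  have hc0 : 0 < ε ^ ((1:ℝ)/3) := Real.rpow_pos_of_pos hε0 _
  have hc3 : ε = (ε ^ ((1:ℝ)/3)) ^ 3 := by
    rw [← Real.rpow_natCast, ← Real.rpow_mul hε0.le]
    norm_num
  have hA : 0 < a * p := mul_pos ha hp0
  refine ⟨fun t ht => ?_, fun t ht => ?_⟩
  · obtain ⟨h1, h2⟩ := ht
    generalize bomega a ε p = w at *
    generalize ε ^ ((1:ℝ)/3) = c at *
    subst hc3
    have hu : 0 < p - t := sub_pos.mpr h2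
    have huc : p - t ≤ c := by linarith
    have h3 : a * p / c ≤ a * c ^ 3 * p / (p - t) ^ 4 := by
      have h4 : a * p / c = a * c ^ 3 * p / c ^ 4 := by field_simp
      rw [h4]
      gcongr
    have h5 : 6 * a * c ^ 3 * p / (p - t) ^ 4 = 6 * (a * c ^ 3 * p / (p - t) ^ 4) := by ring
    rw [h5]
    linarith
  · obtain ⟨h1, h2⟩ := ht
    have hu : 0 < p - t := sub_pos.mpr h2
    rw [deriv_deriv_bpi, deriv_bpi, (hasDerivAt_bkappa a ε hu.ne').deriv,
      (hasDerivAt_deriv_bkappa a ε hu.ne').deriv]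
    unfold bpi bkappa
    generalize bomega a ε p = w at *
    generalize ε ^ ((1:ℝ)/3) = c at *
    subst hc3
    obtain ⟨u, rfl⟩ : ∃ u, t = p - u := ⟨p - t, by ring⟩
    obtain ⟨s, rfl⟩ : ∃ s, c = u + s := ⟨c - u, by ring⟩
    have hs : 0 < s := by linarith
    simp only [sub_sub_cancel] at hu ⊢
    have hgap : 0 < a * p / u - w := by
      have : a * p / (u + s) ≤ a * p / u := by
        gcongr
        linarith
      linarith
    have hts : p - u - (p - (u + s)) = s := by ring
    rw [hts]
    refine ⟨?_, ?_, ?_⟩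
    · have h : 0 < s ^ 3 * (a * p / u - w) := by positivity
      rw [← sub_pos]
      convert h using 1
      field_simp
      ring
    · have h : 0 < 3 * s ^ 2 * (a * p / u - w) + a * p * s ^ 3 / u ^ 2 := by positivity
      rw [← sub_pos]
      convert h using 1
      field_simp
      ring
    · have h : 0 < 6 * s * (a * p / u - w) + 2 * (a * p) * s ^ 2 * (3 * u + s) / u ^ 3 := by
        positivity
      rw [← sub_pos]
      convert h using 1
      field_simp
      ring
end
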